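/- Let R be the difference resultant of n+1 generic difference polynomials P_0, ..., P_n in y_1, ..., y_n of orders s_0, ..., s_n respectively, and set s = s_0 + ... + s_n. Then R equals the algebraic sparse resultant of the system {σ^k P_i : 0 ≤ i ≤ n, 0 ≤ k ≤ s − s_i}, regarded as generic sparse polynomials in the n(s+1) algebraic variables σ^j y_l (1 ≤ l ≤ n, 0 ≤ j ≤ s); in particular ord(R, u_i) = s − s_i for every i. -/

import Mathlib

open MvPolynomial

/-- Index set of the coefficients `u_{iα}` of the generic difference polynomials:
`α` runs over the exponent vectors in the support `A i` of `P_i`. -/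
abbrev CIdx (n : ℕ) (A : Fin (n + 1) → Finset ((Fin n × ℕ) →₀ ℕ)) :=
  Σ i : Fin (n + 1), {α // α ∈ A i}

/-- Variables of the difference polynomial ring `ℚ{Y, u₀,…,uₙ}`:
`Sum.inl (j, t) = σ^t y_j` and `Sum.inr (c, t) = σ^t u_c`. -/
abbrev DVar (n : ℕ) (A : Fin (n + 1) → Finset ((Fin n × ℕ) →₀ ℕ)) :=
  (Fin n × ℕ) ⊕ (CIdx n A × ℕ)

/-- The transforming operator. -/
noncomputable def tauD (n : ℕ) (A : Fin (n + 1) → Finset ((Fin n × ℕ) →₀ ℕ)) :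
    MvPolynomial (DVar n A) ℚ →+* MvPolynomial (DVar n A) ℚ :=
  (MvPolynomial.rename
    (Sum.elim (fun p : Fin n × ℕ => Sum.inl (p.1, p.2 + 1))
      (fun q : CIdx n A × ℕ => Sum.inr (q.1, q.2 + 1)))).toRingHom

/-- The order of `p` in the coefficient set `u_i`. -/
noncomputable def ordUD {n : ℕ} {A : Fin (n + 1) → Finset ((Fin n × ℕ) →₀ ℕ)}
    (p : MvPolynomial (DVar n A) ℚ) (i : Fin (n + 1)) : WithBot ℕ :=
  p.vars.sup (fun v => match v with
    | Sum.inr (⟨i', _⟩, t) => if i' = i then (t : WithBot ℕ) else ⊥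
    | Sum.inl _ => ⊥)

namespace DRes

/-- Elements killed by a map injective on constants are multiples of an irreducible one. -/
theorem dvd_of_map_zero {B M : Type*} [CommRing B] [IsDomain B] [UniqueFactorizationMonoid B]
    [CommRing M] [IsDomain M] (f : Polynomial B →+* M)
    (hf : Function.Injective (f.comp Polynomial.C)) (r g : Polynomial B)
    (hr : Irreducible r) (hfr : f r = 0) (hfg : f g = 0) : r ∣ g := by
  classical
  have : IsGCDMonoid B := inferInstance
  have hdeg : r.natDegree ≠ 0 := by
    intro h
    obtain ⟨b, rfl⟩ := Polynomial.natDegree_eq_zero.mp h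
    have : b = 0 := hf (by simpa using hfr)
    subst this
    simp at hr
  have hprim := hr.isPrimitive hdeg
  apply Polynomial.IsPrimitive.dvd_of_fraction_map_dvd_fraction_map (K := FractionRing B) hprim
  by_contra hnd
  have hirr := (Polynomial.IsPrimitive.irreducible_iff_irreducible_map_fraction_map
    (K := FractionRing B) hprim).mp hr
  obtain ⟨a, b, hab⟩ := (hirr.coprime_iff_not_dvd).mpr hnd
  let ι := algebraMap M (FractionRing M)
  have hι : Function.Injective ι := IsFractionRing.injective M (FractionRing M)
  let h0 : FractionRing B →+* FractionRing M :=
    IsFractionRing.lift (g := ι.comp (f.comp Polynomial.C)) (hι.comp hf)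
  let h1 : Polynomial (FractionRing B) →+* FractionRing M :=
    Polynomial.eval₂RingHom h0 (ι (f Polynomial.X))
  have hh : h1.comp (Polynomial.mapRingHom (algebraMap B (FractionRing B))) = ι.comp f := by
    ext x
    · simp [h1, h0]
    · simp [h1]
  have e : ∀ p, h1 (p.map (algebraMap B (FractionRing B))) = ι (f p) := fun p =>
    RingHom.congr_fun hh p
  have := congrArg h1 hab
  rw [map_add, map_mul, map_mul, e, e, hfr, hfg] at this
  simp at this

/-- Injectivity can be checked modulo `ε`. -/
theorem inj_of_mod {B C : Type*} [CommRing B] [IsDomain B] [CommRing C] [IsDomain C]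
    (ψ : Polynomial B →+* Polynomial C) (hX : ψ Polynomial.X = Polynomial.X)
    (ψ₀ : B →+* C) (hψ₀ : Function.Injective ψ₀)
    (h : ∀ f, (ψ f).coeff 0 = ψ₀ (f.coeff 0)) (f : Polynomial B) (hf : ψ f = 0) : f = 0 := by
  by_contra hne
  obtain ⟨g, hg, hnd⟩ := Polynomial.exists_eq_pow_rootMultiplicity_mul_and_not_dvd f hne 0
  rw [hg] at hf
  simp only [map_zero, sub_zero, map_mul, map_pow, hX] at hf hnd
  have h2 : ψ g = 0 := by
    rcases mul_eq_zero.mp hf with h | h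
    · exact absurd h (pow_ne_zero _ Polynomial.X_ne_zero)
    · exact h
  apply hnd
  rw [Polynomial.X_dvd_iff]
  apply hψ₀
  rw [← h, h2]; simp

/-- The same divisibility in a multivariate ring, with `w` a distinguished variable. -/
theorem mv_dvd {U M : Type*} [CommRing M] [IsDomain M] (f : MvPolynomial U ℚ →+* M) (w : U)
    (hf : ∀ g : MvPolynomial U ℚ, w ∉ g.vars → f g = 0 → g = 0) (r g : MvPolynomial U ℚ)
    (hr : Irreducible r) (hfr : f r = 0) (hfg : f g = 0) : r ∣ g := by
  classical
  let e1 := MvPolynomial.renameEquiv ℚ (Equiv.optionSubtypeNe w)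
  let e2 := MvPolynomial.optionEquivLeft ℚ {x // x ≠ w}
  let e : Polynomial (MvPolynomial {x // x ≠ w} ℚ) ≃ₐ[ℚ] MvPolynomial U ℚ := e2.symm.trans e1
  have heC : ∀ b, e (Polynomial.C b) = rename (Subtype.val) b := by
    intro b
    have : e2.symm (Polynomial.C b) = rename some b := by
      rw [AlgEquiv.symm_apply_eq]
      induction b using MvPolynomial.induction_on with
      | C a => simp [e2]
      | add p q hp hq => simp [hp, hq]
      | mul_X p x hp => simp [hp, e2, MvPolynomial.optionEquivLeft_X_some]
    simp only [e, AlgEquiv.trans_apply, this, e1, renameEquiv_apply, rename_rename]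
    congr 1
  have := dvd_of_map_zero (f.comp e.toRingEquiv.toRingHom) (by
    rw [injective_iff_map_eq_zero]
    intro b hb
    have hb' : f (rename Subtype.val b) = 0 := by
      rw [← heC]; simpa using hb
    have h3 := hf _ (by
      intro hw
      obtain ⟨x, _, hx⟩ := Finset.mem_image.mp (vars_rename _ _ hw)
      exact x.2 hx) hb'
    exact rename_injective _ Subtype.val_injective (by simpa using h3))
    (e.symm r) (e.symm g) ((MulEquiv.irreducible_iff e.symm).mpr hr) (by simpa using hfr)
    (by simpa using hfg)
  simpa using map_dvd e this

/-- Prefix sums partition an interval. -/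
theorem exists_block {n : ℕ} (a : Fin n → ℕ) (k : ℕ) (hk : k < ∑ j, a j) :
    ∃ j, ∑ j' with j' < j, a j' ≤ k ∧ k < (∑ j' with j' < j, a j') + a j := by
  induction n with
  | zero => simp at hk
  | succ n ih =>
    rw [Fin.sum_univ_castSucc] at hk
    have hs : ∀ j : Fin n, ∑ j' with j' < j.castSucc, a j'
        = ∑ j' with j' < j, a j'.castSucc := by
      intro j
      rw [Finset.sum_filter, Finset.sum_filter, Fin.sum_univ_castSucc]
      simp [not_lt.mpr (Fin.le_last j.castSucc)]
    by_cases h : k < ∑ j : Fin n, a j.castSucc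
    · obtain ⟨j, h1, h2⟩ := ih (fun j => a j.castSucc) h
      exact ⟨j.castSucc, by rw [hs]; exact h1, by rw [hs]; exact h2⟩
    · refine ⟨Fin.last n, ?_⟩
      have : ∑ j' with j' < Fin.last n, a j' = ∑ j : Fin n, a j.castSucc := by
        rw [Finset.sum_filter, Fin.sum_univ_castSucc]
        simp [Fin.castSucc_lt_last]
      rw [this]; omega

/-- The matching between the prolonged system minus one member and the variables. -/
theorem exists_matching (n : ℕ) (hn : 1 ≤ n) (sord : Fin (n + 1) → ℕ) (s : ℕ) (hs : s = ∑ i, sord i)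
    (i₀ : Fin (n + 1)) :
    ∃ μ : Fin (n + 1) × ℕ → Fin n × ℕ,
      Set.InjOn μ {p | p.2 ≤ s - sord p.1 ∧ p ≠ (i₀, s - sord i₀)} ∧
      ∀ p ∈ {p : Fin (n + 1) × ℕ | p.2 ≤ s - sord p.1 ∧ p ≠ (i₀, s - sord i₀)},
        p.2 ≤ (μ p).2 ∧ (μ p).2 ≤ p.2 + sord p.1 := by
  classical
  let a : Fin n → ℕ := fun j => sord (i₀.succAbove j)
  have hsum : s - sord i₀ = ∑ j, a j := by
    rw [hs, Fin.sum_univ_succAbove _ i₀]; simp [a]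
  let pre : Fin n → ℕ := fun j => ∑ j' with j' < j, a j'
  have hex : ∀ p : Fin (n + 1) × ℕ, ∃ q : Fin n × ℕ,
      (p.2 ≤ s - sord p.1 ∧ p ≠ (i₀, s - sord i₀)) →
        ((p.1 = i₀ ∧ q.2 = p.2 ∧ pre q.1 ≤ q.2 ∧ q.2 < pre q.1 + a q.1) ∨
        (p.1 = i₀.succAbove q.1 ∧ ((p.2 < pre q.1 ∧ q.2 = p.2) ∨
          (pre q.1 ≤ p.2 ∧ q.2 = p.2 + a q.1)))) := by
    rintro ⟨i, k⟩
    by_cases hT : k ≤ s - sord i ∧ (i, k) ≠ (i₀, s - sord i₀)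
    · by_cases hi : i = i₀
      · subst hi
        have hk : k < ∑ j, a j := by
          rw [← hsum]
          refine lt_of_le_of_ne hT.1 ?_
          rintro rfl
          exact hT.2 rfl
        obtain ⟨j, h1, h2⟩ := exists_block a k hk
        exact ⟨(j, k), fun _ => Or.inl ⟨rfl, rfl, h1, h2⟩⟩
      · obtain ⟨j, rfl⟩ := Fin.exists_succAbove_eq hi
        by_cases hk : k < pre j
        · exact ⟨(j, k), fun _ => Or.inr ⟨rfl, Or.inl ⟨hk, rfl⟩⟩⟩
        · exact ⟨(j, k + a j), fun _ => Or.inr ⟨rfl, Or.inr ⟨not_lt.mp hk, rfl⟩⟩⟩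
    · exact ⟨(⟨0, hn⟩, 0), fun h => absurd h hT⟩
  choose μ hμ using hex
  refine ⟨μ, ?_, ?_⟩
  · rintro ⟨i, k⟩ hp ⟨i', k'⟩ hp' heq
    have h1 := hμ _ hp
    have h2 := hμ _ hp'
    rw [← heq] at h2
    simp only at h1 h2
    rcases h1 with ⟨h1, h1'⟩ | ⟨h1, h1'⟩ <;> rcases h2 with ⟨h2, h2'⟩ | ⟨h2, h2'⟩ <;>
      first
      | (have hi : i = i' := by rw [h1, h2]
         have hk : k = k' := by omega
         rw [hi, hk])
      | (exfalso; omega)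
  · rintro ⟨i, k⟩ hp
    rcases hμ _ hp with ⟨h1, h1'⟩ | ⟨h1, h1'⟩
    · simp only at h1' ⊢; omega
    · simp only at h1 h1' ⊢
      have : a (μ (i, k)).1 = sord i := by simp only [a]; rw [← h1]
      omega

section
variable {n : ℕ} {A : Fin (n + 1) → Finset ((Fin n × ℕ) →₀ ℕ)}

open Classical in
/-- `σ^k (P_i - u_{i0})`. -/
noncomputable def zeta (i : Fin (n + 1)) (k : ℕ) : MvPolynomial (DVar n A) ℚ :=
  ∑ α ∈ (A i).attach, if (α : (Fin n × ℕ) →₀ ℕ) = 0 then 0 else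
    X (Sum.inr (⟨⟨i, α⟩, k⟩ : CIdx n A × ℕ)) *
      (α : (Fin n × ℕ) →₀ ℕ).prod
        (fun v c => (X (Sum.inl (v.1, v.2 + k)) : MvPolynomial (DVar n A) ℚ) ^ c)

open Classical in
/-- Solving `σ^k P_i = 0`, `(i,k) ∈ T`, for the constant coefficients. -/
noncomputable def phi (T : Set (Fin (n + 1) × ℕ)) :
    MvPolynomial (DVar n A) ℚ →ₐ[ℚ] MvPolynomial (DVar n A) ℚ :=
  aeval (Sum.elim (fun v => X (Sum.inl v))
    (fun q : CIdx n A × ℕ => if (q.1.2 : (Fin n × ℕ) →₀ ℕ) = 0 ∧ (q.1.1, q.2) ∈ T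
      then - zeta q.1.1 q.2 else X (Sum.inr q)))

theorem phi_inl (T : Set (Fin (n + 1) × ℕ)) (v : Fin n × ℕ) :
    phi (A := A) T (X (Sum.inl v)) = X (Sum.inl v) := by
  simp [phi]

theorem phi_inr_of_not (T : Set (Fin (n + 1) × ℕ)) (q : CIdx n A × ℕ)
    (h : ¬ ((q.1.2 : (Fin n × ℕ) →₀ ℕ) = 0 ∧ (q.1.1, q.2) ∈ T)) :
    phi (A := A) T (X (Sum.inr q)) = X (Sum.inr q) := by
  simp only [phi, aeval_X, Sum.elim_inr, if_neg h]

theorem phi_inr_of (T : Set (Fin (n + 1) × ℕ)) (q : CIdx n A × ℕ)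
    (h : (q.1.2 : (Fin n × ℕ) →₀ ℕ) = 0 ∧ (q.1.1, q.2) ∈ T) :
    phi (A := A) T (X (Sum.inr q)) = - zeta q.1.1 q.2 := by
  simp only [phi, aeval_X, Sum.elim_inr, if_pos h]

theorem phi_zeta (T : Set (Fin (n + 1) × ℕ)) (i : Fin (n + 1)) (k : ℕ) :
    phi (A := A) T (zeta i k) = zeta i k := by
  unfold zeta
  rw [map_sum]
  refine Finset.sum_congr rfl fun α _ => ?_
  split_ifs with h
  · simp
  · rw [map_mul, phi_inr_of_not _ _ (by simp [h]), map_finsuppProd]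
    simp only [map_pow, phi_inl]

theorem tau_pow_inl (t : ℕ) (v : Fin n × ℕ) :
    (tauD n A ^ t) (X (Sum.inl v)) = X (Sum.inl (v.1, v.2 + t)) := by
  induction t with
  | zero => simp
  | succ t ih =>
    rw [pow_succ', RingHom.mul_def, RingHom.comp_apply, ih]
    simp [tauD, add_assoc]

theorem tau_pow_inr (t : ℕ) (v : CIdx n A × ℕ) :
    (tauD n A ^ t) (X (Sum.inr v)) = X (Sum.inr (v.1, v.2 + t)) := by
  induction t with
  | zero => simp
  | succ t ih =>
    rw [pow_succ', RingHom.mul_def, RingHom.comp_apply, ih]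
    simp [tauD, add_assoc]

theorem tau_P (P : Fin (n + 1) → MvPolynomial (DVar n A) ℚ)
    (hP : ∀ i, P i = ∑ α ∈ (A i).attach,
      X (Sum.inr (⟨⟨i, α⟩, 0⟩ : CIdx n A × ℕ)) *
        (α : (Fin n × ℕ) →₀ ℕ).prod (fun v c => (X (Sum.inl v) : MvPolynomial (DVar n A) ℚ) ^ c))
    (i : Fin (n + 1)) (h0 : (0 : (Fin n × ℕ) →₀ ℕ) ∈ A i) (k : ℕ) :
    (tauD n A ^ k) (P i) = X (Sum.inr (⟨⟨i, ⟨0, h0⟩⟩, k⟩ : CIdx n A × ℕ)) + zeta i k := by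
  classical
  rw [hP, map_sum, zeta]
  have e : (X (Sum.inr (⟨⟨i, ⟨0, h0⟩⟩, k⟩ : CIdx n A × ℕ)) : MvPolynomial (DVar n A) ℚ) =
      ∑ α ∈ (A i).attach, if α = ⟨0, h0⟩ then X (Sum.inr (⟨⟨i, α⟩, k⟩ : CIdx n A × ℕ)) else 0 := by
    rw [Finset.sum_ite_eq' (A i).attach]
    simp
  rw [e, ← Finset.sum_add_distrib]
  refine Finset.sum_congr rfl fun α _ => ?_
  rw [map_mul, tau_pow_inr, map_finsuppProd]
  simp only [map_pow, tau_pow_inl, zero_add]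
  by_cases h : α = ⟨0, h0⟩
  · subst h; simp
  · have h' : (α : (Fin n × ℕ) →₀ ℕ) ≠ 0 := fun hh => h (Subtype.ext hh)
    simp [h, h']

theorem mem_span_iff (P : Fin (n + 1) → MvPolynomial (DVar n A) ℚ)
    (hP : ∀ i, P i = ∑ α ∈ (A i).attach,
      X (Sum.inr (⟨⟨i, α⟩, 0⟩ : CIdx n A × ℕ)) *
        (α : (Fin n × ℕ) →₀ ℕ).prod (fun v c => (X (Sum.inl v) : MvPolynomial (DVar n A) ℚ) ^ c))
    (h0 : ∀ i, (0 : (Fin n × ℕ) →₀ ℕ) ∈ A i) (T : Set (Fin (n + 1) × ℕ))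
    (p : MvPolynomial (DVar n A) ℚ) :
    p ∈ Ideal.span {q | ∃ x ∈ T, q = (tauD n A ^ x.2) (P x.1)} ↔ phi T p = 0 := by
  constructor
  · intro h
    have : Ideal.span {q | ∃ x ∈ T, q = (tauD n A ^ x.2) (P x.1)} ≤
        RingHom.ker (phi (A := A) T).toRingHom := by
      rw [Ideal.span_le]
      rintro q ⟨x, hx, rfl⟩
      change phi T _ = 0
      rw [tau_P P hP x.1 (h0 _), map_add, phi_zeta, phi_inr_of _ _ ⟨rfl, hx⟩]
      simp
    exact this h
  · intro h
    set I := Ideal.span {q | ∃ x ∈ T, q = (tauD n A ^ x.2) (P x.1)} with hI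
    have key : (Ideal.Quotient.mkₐ ℚ I).comp (phi T) = Ideal.Quotient.mkₐ ℚ I := by
      apply MvPolynomial.algHom_ext
      rintro (v | q)
      · simp only [AlgHom.comp_apply, phi_inl]
      · by_cases hq : (q.1.2 : (Fin n × ℕ) →₀ ℕ) = 0 ∧ (q.1.1, q.2) ∈ T
        · simp only [AlgHom.comp_apply, phi_inr_of _ _ hq]
          rw [eq_comm, Ideal.Quotient.mkₐ_eq_mk, Ideal.Quotient.eq, sub_neg_eq_add]
          apply Ideal.subset_span
          refine ⟨(q.1.1, q.2), hq.2, ?_⟩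
          rw [tau_P P hP _ (h0 _)]
          obtain ⟨⟨i, α⟩, k⟩ := q
          obtain ⟨hq1, _⟩ := hq
          have : α = ⟨0, h0 i⟩ := Subtype.ext hq1
          subst this
          rfl
        · simp only [AlgHom.comp_apply, phi_inr_of_not _ _ hq]
    have := AlgHom.congr_fun key p
    rw [AlgHom.comp_apply, h, map_zero] at this
    exact Ideal.Quotient.eq_zero_iff_mem.mp this.symm

theorem phi_congr (T T' : Set (Fin (n + 1) × ℕ)) (p : MvPolynomial (DVar n A) ℚ)
    (h : ∀ q : CIdx n A × ℕ, Sum.inr q ∈ p.vars → (q.1.2 : (Fin n × ℕ) →₀ ℕ) = 0 →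
      ((q.1.1, q.2) ∈ T ↔ (q.1.1, q.2) ∈ T')) : phi T p = phi T' p := by
  refine MvPolynomial.hom_congr_vars (f₁ := (phi T).toRingHom) (f₂ := (phi T').toRingHom)
    (p₁ := p) (p₂ := p) (by ext; simp) ?_ rfl
  rintro (v | q) hv _
  · change phi T _ = phi T' _
    rw [phi_inl, phi_inl]
  · change phi T _ = phi T' _
    have := h q hv
    by_cases h1 : (q.1.2 : (Fin n × ℕ) →₀ ℕ) = 0 ∧ (q.1.1, q.2) ∈ T
    · rw [phi_inr_of _ _ h1, phi_inr_of _ _ ⟨h1.1, (this h1.1).mp h1.2⟩]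
    · rw [phi_inr_of_not _ _ h1, phi_inr_of_not]
      rintro ⟨h2, h3⟩
      exact h1 ⟨h2, (this h2).mpr h3⟩

open Classical in
/-- The deformation `u ↦ c + ε u` of the nonconstant coefficients. -/
noncomputable def theta (c : CIdx n A × ℕ → ℚ) :
    MvPolynomial (DVar n A) ℚ →ₐ[ℚ] Polynomial (MvPolynomial (DVar n A) ℚ) :=
  aeval (Sum.elim (fun v => Polynomial.C (X (Sum.inl v)))
    (fun q => Polynomial.C (C (c q)) +
      (if (q.1.2 : (Fin n × ℕ) →₀ ℕ) = 0 then 1 else Polynomial.X) * Polynomial.C (X (Sum.inr q))))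

open Classical in
/-- The same deformation on the coefficient ring. -/
noncomputable def thetaU (c : CIdx n A × ℕ → ℚ) :
    MvPolynomial (CIdx n A × ℕ) ℚ →ₐ[ℚ] Polynomial (MvPolynomial (CIdx n A × ℕ) ℚ) :=
  aeval (fun q => Polynomial.C (C (c q)) +
      (if (q.1.2 : (Fin n × ℕ) →₀ ℕ) = 0 then 1 else Polynomial.X) * Polynomial.C (X q))

theorem thetaU_inj (c : CIdx n A × ℕ → ℚ) (g : MvPolynomial (CIdx n A × ℕ) ℚ)
    (h : thetaU c g = 0) : g = 0 := by
  let e : Polynomial (MvPolynomial (CIdx n A × ℕ) ℚ) →ₐ[ℚ] MvPolynomial (CIdx n A × ℕ) ℚ :=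
    (Polynomial.aeval (1 : MvPolynomial (CIdx n A × ℕ) ℚ)).restrictScalars ℚ
  let t : MvPolynomial (CIdx n A × ℕ) ℚ →ₐ[ℚ] MvPolynomial (CIdx n A × ℕ) ℚ :=
    aeval (fun q => X q - C (c q))
  have : (t.comp (e.comp (thetaU c))) = AlgHom.id ℚ _ := by
    apply MvPolynomial.algHom_ext
    intro q
    simp only [AlgHom.comp_apply, thetaU, aeval_X, AlgHom.id_apply]
    split_ifs <;> simp [e, t]
  have h2 := AlgHom.congr_fun this g
  rw [AlgHom.comp_apply, AlgHom.comp_apply, h] at h2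
  simpa using h2.symm

theorem core (T : Set (Fin (n + 1) × ℕ)) (sord : Fin (n + 1) → ℕ)
    (hA1 : ∀ i j t, t ≤ sord i → Finsupp.single (j, t) 1 ∈ A i)
    (μ : Fin (n + 1) × ℕ → Fin n × ℕ) (hinj : Set.InjOn μ T)
    (hμ : ∀ p ∈ T, p.2 ≤ (μ p).2 ∧ (μ p).2 ≤ p.2 + sord p.1)
    (g : MvPolynomial (CIdx n A × ℕ) ℚ) (hg : phi T (rename Sum.inr g) = 0) : g = 0 := by
  classical
  let e : Fin (n + 1) × ℕ → ((Fin n × ℕ) →₀ ℕ) := fun p =>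
    Finsupp.single ((μ p).1, (μ p).2 - p.2) 1
  have he : ∀ p, e p ≠ 0 := fun p => by simp [e]
  let c : CIdx n A × ℕ → ℚ := fun q =>
    if (q.1.1, q.2) ∈ T ∧ (q.1.2 : (Fin n × ℕ) →₀ ℕ) = e (q.1.1, q.2) then -1 else 0
  have hc0 : ∀ q : CIdx n A × ℕ, (q.1.2 : (Fin n × ℕ) →₀ ℕ) = 0 → c q = 0 := by
    intro q hq
    simp only [c]
    rw [if_neg]
    rintro ⟨_, h⟩
    exact he _ (h.symm.trans hq)
  let ψ1 : MvPolynomial (CIdx n A × ℕ) ℚ →ₐ[ℚ] Polynomial (MvPolynomial (DVar n A) ℚ) :=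
    aeval (fun q => if (q.1.2 : (Fin n × ℕ) →₀ ℕ) = 0 ∧ (q.1.1, q.2) ∈ T
      then theta c (- zeta q.1.1 q.2) else Polynomial.C (X (Sum.inr q)))
  let ψ : Polynomial (MvPolynomial (CIdx n A × ℕ) ℚ) →+* Polynomial (MvPolynomial (DVar n A) ℚ) :=
    Polynomial.eval₂RingHom ψ1.toRingHom Polynomial.X
  let f0 : CIdx n A × ℕ → DVar n A := fun q =>
    if (q.1.2 : (Fin n × ℕ) →₀ ℕ) = 0 ∧ (q.1.1, q.2) ∈ T then Sum.inl (μ (q.1.1, q.2))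
    else Sum.inr q
  have hf0 : Function.Injective f0 := by
    intro q q' h
    simp only [f0] at h
    split_ifs at h with h1 h2 h2
    · have := hinj h1.2 h2.2 (Sum.inl.inj h)
      obtain ⟨⟨i, α, hα⟩, k⟩ := q
      obtain ⟨⟨i', α', hα'⟩, k'⟩ := q'
      simp only [Prod.mk.injEq] at this h1 h2
      obtain ⟨rfl, rfl⟩ := this
      obtain ⟨rfl, _⟩ := h1
      obtain ⟨rfl, _⟩ := h2
      rfl
    · exact Sum.inr.inj h
  have hψC : ∀ b, ψ (Polynomial.C b) = ψ1 b := fun b => by simp [ψ]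
  -- commutation
  have hcomm : ψ (thetaU c g) = theta c (phi T (rename Sum.inr g)) := by
    have : ψ.comp (thetaU c).toRingHom =
        ((theta c).comp ((phi T).comp (rename Sum.inr))).toRingHom := by
      apply MvPolynomial.ringHom_ext
      · intro r; simp [ψ]
      · intro q
        change ψ (thetaU c (X q)) = theta c (phi T (rename Sum.inr (X q)))
        rw [rename_X]
        simp only [thetaU, aeval_X, map_add, map_mul, hψC]
        have hCC : ψ1 (C (c q)) = Polynomial.C (C (c q)) := by
          have := ψ1.commutes (c q)
          simpa using this
        by_cases h0 : (q.1.2 : (Fin n × ℕ) →₀ ℕ) = 0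
        · rw [hc0 q h0, if_pos h0]
          by_cases h1 : (q.1.1, q.2) ∈ T
          · rw [phi_inr_of _ _ ⟨h0, h1⟩]
            simp [ψ1, h0, h1]
          · rw [phi_inr_of_not _ _ (by tauto)]
            simp [ψ1, h0, h1, theta, hc0 q h0]
        · rw [phi_inr_of_not _ _ (by tauto), hCC]
          simp [ψ1, h0, theta, ψ]
    exact RingHom.congr_fun this g
  -- reduction mod ε
  have hz : ∀ i k, (i, k) ∈ T →
      (theta c (zeta (A := A) i k)).coeff 0 = - X (Sum.inl (μ (i, k))) := by
    intro i k hT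
    have hm := hμ _ hT
    have hmem : e (i, k) ∈ A i := hA1 i _ _ (by simp only at hm ⊢; omega)
    change Polynomial.constantCoeff (theta c _) = _
    rw [zeta, map_sum, map_sum, Finset.sum_eq_single ⟨e (i, k), hmem⟩]
    · rw [if_neg (he _), map_mul, map_mul]
      have h1 : Polynomial.constantCoeff (theta c (X (Sum.inr (⟨⟨i, ⟨e (i, k), hmem⟩⟩, k⟩ :
          CIdx n A × ℕ)))) = -1 := by
        simp [theta, he, c, hT]
      rw [h1]
      simp only [e]
      rw [Finsupp.prod_single_index (by simp)]
      simp only [pow_one, Nat.sub_add_cancel hm.1]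
      simp [theta]
    · intro α _ hα
      split_ifs with h0
      · simp
      · rw [map_mul, map_mul]
        have h1 : Polynomial.constantCoeff (theta c (X (Sum.inr (⟨⟨i, α⟩, k⟩ :
          CIdx n A × ℕ)))) = 0 := by
          have : (α : (Fin n × ℕ) →₀ ℕ) ≠ e (i, k) := fun h => hα (Subtype.ext h)
          simp [theta, h0, c, this]
        rw [h1, zero_mul]
    · intro h; exact absurd (Finset.mem_attach _ _) h
  have hmod : ∀ f, (ψ f).coeff 0 = (rename f0).toRingHom (f.coeff 0) := by
    have : Polynomial.constantCoeff.comp ψ =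
        (rename (R := ℚ) f0).toRingHom.comp Polynomial.constantCoeff := by
      apply Polynomial.ringHom_ext'
      · apply MvPolynomial.ringHom_ext
        · intro r; simp [ψ]
        · intro q
          simp only [RingHom.comp_apply, hψC]
          simp only [ψ1, aeval_X, f0]
          split_ifs with h
          · rw [map_neg, map_neg, Polynomial.constantCoeff_apply, hz _ _ h.2]
            simp [h]
          · simp [h]
      · simp [ψ]
    intro f
    exact RingHom.congr_fun this f
  apply thetaU_inj c
  refine inj_of_mod ψ (by simp [ψ]) (rename f0).toRingHom (rename_injective _ hf0) hmod _ ?_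
  rw [hcomm, hg, map_zero]

end

section
variable {n : ℕ} {A : Fin (n + 1) → Finset ((Fin n × ℕ) →₀ ℕ)}

theorem ordUD_le_iff (p : MvPolynomial (DVar n A) ℚ) (i : Fin (n + 1)) (N : ℕ) :
    ordUD p i ≤ (N : WithBot ℕ) ↔
      ∀ q : CIdx n A × ℕ, Sum.inr q ∈ p.vars → q.1.1 = i → q.2 ≤ N := by
  unfold ordUD
  rw [Finset.sup_le_iff]
  constructor
  · rintro h ⟨⟨i', α⟩, t⟩ hq rfl
    have := h _ hq
    simpa using this
  · rintro h (v | ⟨⟨i', α⟩, t⟩) hv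
    · simp
    · have := h _ hv
      simp only at this ⊢
      split_ifs with hi
      · exact_mod_cast this hi
      · simp

theorem le_ordUD (p : MvPolynomial (DVar n A) ℚ) (q : CIdx n A × ℕ)
    (hq : Sum.inr q ∈ p.vars) : (q.2 : WithBot ℕ) ≤ ordUD p q.1.1 := by
  unfold ordUD
  refine le_trans ?_ (Finset.le_sup hq)
  simp

theorem zeta_supported (sord : Fin (n + 1) → ℕ) (s : ℕ) (hle : ∀ i, sord i ≤ s)
    (hA : ∀ i α, α ∈ A i → ∀ v ∈ α.support, v.2 ≤ sord i) (i : Fin (n + 1)) (k : ℕ)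
    (hk : k ≤ s - sord i) (G : Set (DVar n A))
    (hG1 : ∀ v : Fin n × ℕ, v.2 ≤ s → Sum.inl v ∈ G)
    (hG2 : ∀ q : CIdx n A × ℕ, q.2 ≤ s - sord q.1.1 → (q.1.2 : (Fin n × ℕ) →₀ ℕ) ≠ 0 →
      Sum.inr q ∈ G) : zeta (A := A) i k ∈ supported ℚ G := by
  unfold zeta
  refine sum_mem fun α _ => ?_
  split_ifs with h
  · exact zero_mem _
  · refine mul_mem ((X_mem_supported).mpr (hG2 _ hk h)) ?_
    refine prod_mem fun v hv => pow_mem ((X_mem_supported).mpr (hG1 _ ?_)) _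
    have := hA i _ α.2 v hv
    have := hle i
    simp only
    omega

theorem exists_relation (sord : Fin (n + 1) → ℕ) (s : ℕ) (hs : s = ∑ i, sord i)
    (h0 : ∀ i, (0 : (Fin n × ℕ) →₀ ℕ) ∈ A i)
    (hA : ∀ i α, α ∈ A i → ∀ v ∈ α.support, v.2 ≤ sord i) :
    ∃ g : MvPolynomial (CIdx n A × ℕ) ℚ, g ≠ 0 ∧ (∀ q ∈ g.vars, q.2 ≤ s - sord q.1.1) ∧
      phi {p | p.2 ≤ s - sord p.1} (rename Sum.inr g) = 0 := by
  classical
  have hle : ∀ i, sord i ≤ s := fun i => by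
    rw [hs]; exact Finset.single_le_sum (fun _ _ => Nat.zero_le _) (Finset.mem_univ i)
  let F := {q : CIdx n A × ℕ // q.2 ≤ s - sord q.1.1}
  let T : Set (Fin (n + 1) × ℕ) := {p | p.2 ≤ s - sord p.1}
  have : Finite F := Finite.of_injective
    (fun q : F => ((q.1.1, ⟨q.1.2, by have := q.2; omega⟩) : CIdx n A × Fin (s + 1))) (by
      rintro ⟨⟨a, b⟩, h⟩ ⟨⟨a', b'⟩, h'⟩ hh
      simp only [Prod.mk.injEq, Fin.mk.injEq] at hh
      obtain ⟨rfl, rfl⟩ := hh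
      rfl)
  let _ : Fintype F := Fintype.ofFinite F
  let Z : F → Prop := fun q => (q.1.1.2 : (Fin n × ℕ) →₀ ℕ) = 0
  let G := (Fin n × Fin (s + 1)) ⊕ {q : F // ¬ Z q}
  let j : G → DVar n A := Sum.elim (fun v => Sum.inl (v.1, (v.2 : ℕ))) (fun q => Sum.inr q.1.1)
  have hj : Function.Injective j := by
    rintro (⟨a, b⟩ | q) (⟨a', b'⟩ | q') h
    · simp only [j, Sum.elim_inl, Sum.inl.injEq, Prod.mk.injEq] at h
      obtain ⟨rfl, h⟩ := h
      rw [Fin.ext h]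
    · simp [j] at h
    · simp [j] at h
    · simp only [j, Sum.elim_inr, Sum.inr.injEq] at h
      rw [Subtype.ext (Subtype.ext h)]
  have hcard : Fintype.card G < Fintype.card F := by
    have h1 : Fintype.card F = Fintype.card {q : F // Z q} + Fintype.card {q : F // ¬ Z q} := by
      rw [← Fintype.card_sum]
      exact (Fintype.card_congr (Equiv.sumCompl Z)).symm
    have h2 : Fintype.card G = n * (s + 1) + Fintype.card {q : F // ¬ Z q} := by
      simp only [G, Fintype.card_sum, Fintype.card_prod, Fintype.card_fin]
    have h3 : ∑ i, (s - sord i + 1) ≤ Fintype.card {q : F // Z q} := by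
      have : Fintype.card (Σ i : Fin (n + 1), Fin (s - sord i + 1)) = ∑ i, (s - sord i + 1) := by
        simp
      rw [← this]
      refine Fintype.card_le_of_injective (fun x => (⟨⟨(⟨x.1, ⟨0, h0 x.1⟩⟩, (x.2 : ℕ)),
        Nat.le_of_lt_succ x.2.2⟩, rfl⟩ : {q : F // Z q})) ?_
      rintro ⟨i, k⟩ ⟨i', k'⟩ h
      have h' := congrArg (fun q : {q : F // Z q} => (q.1.1.1.1, q.1.1.2)) h
      simp only [Prod.mk.injEq] at h'
      obtain ⟨rfl, h'⟩ := h'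
      rw [Fin.ext h']
    have h4 : ∑ i, (s - sord i + 1) + s = (n + 1) * (s + 1) := by
      have h6 : ∑ i, (s - sord i + 1) + s = ∑ i, (s - sord i + 1) + ∑ i, sord i := by
        rw [← hs]
      rw [h6, ← Finset.sum_add_distrib]
      rw [Finset.sum_congr rfl (g := fun _ => s + 1) (fun i _ => by have := hle i; omega)]
      simp
    have h5 : (n + 1) * (s + 1) = n * (s + 1) + s + 1 := by ring
    omega
  have hx : ∀ q : F, ∃ x' : MvPolynomial G ℚ, rename j x' = phi T (X (Sum.inr q.1)) := by
    intro q
    apply exists_rename_eq_of_vars_subset_range _ _ hj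
    rw [← mem_supported]
    by_cases hq : Z q
    · rw [phi_inr_of _ _ ⟨hq, q.2⟩]
      refine neg_mem (zeta_supported sord s hle hA _ _ q.2 _ ?_ ?_)
      · intro v hv
        exact ⟨Sum.inl (v.1, ⟨v.2, by omega⟩), rfl⟩
      · intro q' hq' hz
        exact ⟨Sum.inr ⟨⟨q', hq'⟩, hz⟩, rfl⟩
    · rw [phi_inr_of_not _ _ (fun h => hq h.1)]
      exact X_mem_supported.mpr ⟨Sum.inr ⟨q, hq⟩, rfl⟩
  choose x' hx' using hx
  have hdep : ¬ AlgebraicIndependent ℚ x' := by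
    intro h
    have h1 := h.lift_cardinalMk_le_trdeg
    rw [MvPolynomial.trdeg_of_isDomain] at h1
    simp only [Cardinal.mk_fintype, Cardinal.lift_natCast, Nat.cast_le] at h1
    omega
  rw [algebraicIndependent_iff] at hdep
  push Not at hdep
  obtain ⟨g, hg, hgne⟩ := hdep
  refine ⟨rename Subtype.val g, ?_, ?_, ?_⟩
  · intro h
    exact hgne (rename_injective _ Subtype.val_injective (by simpa using h))
  · intro q hq
    obtain ⟨q', _, rfl⟩ := mem_vars_rename _ _ hq
    exact q'.2
  · have : (phi T).comp ((rename Sum.inr).comp (rename (Subtype.val : F → _)))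
        = (rename j).comp (aeval x') := by
      apply MvPolynomial.algHom_ext
      intro q
      simp [hx']
    have := AlgHom.congr_fun this g
    simp only [AlgHom.comp_apply, hg, map_zero] at this
    exact this

theorem irreducible_of_rename {U V : Type*} (g : MvPolynomial U ℚ)
    (h : Irreducible (rename (Sum.inr : U → V ⊕ U) g)) : Irreducible g := by
  let r : MvPolynomial (V ⊕ U) ℚ →ₐ[ℚ] MvPolynomial U ℚ := aeval (Sum.elim (fun _ => 0) X)
  have hr : ∀ p, r (rename Sum.inr p) = p := by
    intro p
    have : r.comp (rename Sum.inr) = AlgHom.id ℚ _ := by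
      apply MvPolynomial.algHom_ext
      intro i; simp [r]
    exact AlgHom.congr_fun this p
  have hu : ∀ p : MvPolynomial U ℚ, IsUnit (rename (Sum.inr : U → V ⊕ U) p) → IsUnit p := by
    intro p hp
    have := hp.map r
    rwa [hr] at this
  refine ⟨fun hg => h.not_isUnit (hg.map (rename Sum.inr)), ?_⟩
  intro a b hab
  rcases h.isUnit_or_isUnit (a := rename Sum.inr a) (b := rename Sum.inr b)
    (by rw [hab, map_mul]) with h' | h'
  · exact Or.inl (hu _ h')
  · exact Or.inr (hu _ h')

theorem phi_mY (T : Set (Fin (n + 1) × ℕ)) (M : MvPolynomial (DVar n A) ℚ)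
    (hM : M ∈ Submonoid.closure
      (Set.range fun v : Fin n × ℕ => (X (Sum.inl v) : MvPolynomial (DVar n A) ℚ))) :
    phi T M = M ∧ M ≠ 0 := by
  induction hM using Submonoid.closure_induction with
  | mem x hx =>
    obtain ⟨v, rfl⟩ := hx
    exact ⟨phi_inl _ _, X_ne_zero _⟩
  | one => exact ⟨map_one _, one_ne_zero⟩
  | mul x y _ _ hx hy => exact ⟨by rw [map_mul, hx.1, hy.1], mul_ne_zero hx.2 hy.2⟩

end

end DRes

/-- the difference resultant `R` of the generic difference polynomials
`P₀,…,Pₙ` of orders `s₀,…,sₙ` (and positive degrees `m_i`), with `s = s₀ + ⋯ + sₙ`,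
equals the algebraic sparse resultant of the prolonged system
`{σ^k P_i : 0 ≤ k ≤ s − s_i}`: it generates the elimination ideal of the coefficients
of that algebraic system; in particular `ord(R, u_i) = s − s_i` for every `i`. -/
theorem stmt_18 (n : ℕ) (hn : 1 ≤ n) (sord : Fin (n + 1) → ℕ) (m : Fin (n + 1) → ℕ)
    (hm : ∀ i, 1 ≤ m i) (s : ℕ) (hs : s = ∑ i, sord i)
    (A : Fin (n + 1) → Finset ((Fin n × ℕ) →₀ ℕ))
    -- `A i` is the full support of a generic difference polynomial of order `s_i`
    -- and degree `m_i`: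
    (hA : ∀ i α, α ∈ A i ↔ ((∀ v ∈ α.support, v.2 ≤ sord i) ∧ (α.sum fun _ c => c) ≤ m i))
    (P : Fin (n + 1) → MvPolynomial (DVar n A) ℚ)
    (hP : ∀ i, P i = ∑ α ∈ (A i).attach,
      X (Sum.inr (⟨⟨i, α⟩, 0⟩ : CIdx n A × ℕ)) *
        (α : (Fin n × ℕ) →₀ ℕ).prod (fun v c => (X (Sum.inl v) : MvPolynomial (DVar n A) ℚ) ^ c))
    -- `R` is the difference resultant of `P₀,…,Pₙ`: the irreducible difference polynomial
    -- in the coefficients alone, lying in `[P₀,…,Pₙ] : 𝕞`, of minimal order and degree: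
    (mY : Submonoid (MvPolynomial (DVar n A) ℚ))
    (hmY : mY = Submonoid.closure
      (Set.range fun v : Fin n × ℕ => (X (Sum.inl v) : MvPolynomial (DVar n A) ℚ)))
    (SatSet : Set (MvPolynomial (DVar n A) ℚ))
    (hSat : SatSet = {p | ∃ M ∈ mY, M * p ∈
      Ideal.span (⋃ t : ℕ, (fun q => (tauD n A ^ t) q) '' Set.range P)})
    (R : MvPolynomial (DVar n A) ℚ)
    (hRu : ∀ v ∈ R.vars, ∃ c t, v = Sum.inr (c, t))
    (hRmem : R ∈ SatSet)
    (hRirr : Irreducible R)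
    (hRminord : ∀ p ∈ SatSet, (∀ v ∈ p.vars, ∃ c t, v = Sum.inr (c, t)) → p ≠ 0 →
      ∀ i, ordUD R i ≤ ordUD p i)
    (hRmindeg : ∀ p ∈ SatSet, (∀ v ∈ p.vars, ∃ c t, v = Sum.inr (c, t)) → p ≠ 0 →
      (∀ i, ordUD p i = ordUD R i) → R.totalDegree ≤ p.totalDegree) :
    (∀ g : MvPolynomial (DVar n A) ℚ, (∀ v ∈ g.vars, ∃ c t, v = Sum.inr (c, t)) →
      (g ∈ Ideal.span {q | ∃ i : Fin (n + 1), ∃ k ≤ s - sord i, q = (tauD n A ^ k) (P i)} ↔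
        R ∣ g)) ∧
    (∀ i : Fin (n + 1), ordUD R i = ((s - sord i : ℕ) : WithBot ℕ)) := by
  classical
  have h0 : ∀ i, (0 : (Fin n × ℕ) →₀ ℕ) ∈ A i := fun i => (hA i 0).mpr (by simp)
  have hA' : ∀ i α, α ∈ A i → ∀ v ∈ α.support, v.2 ≤ sord i := fun i α h => ((hA i α).mp h).1
  have hA1 : ∀ i j t, t ≤ sord i → Finsupp.single (j, t) 1 ∈ A i := by
    intro i j t ht
    rw [hA]
    refine ⟨fun v hv => ?_, ?_⟩
    · have := Finsupp.support_single_subset hv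
      rw [Finset.mem_singleton] at this
      rw [this]; exact ht
    · rw [Finsupp.sum_single_index rfl]; exact hm i
  set T : Set (Fin (n + 1) × ℕ) := {p | p.2 ≤ s - sord p.1} with hT
  have hJ : ∀ p, p ∈ Ideal.span {q | ∃ i : Fin (n + 1), ∃ k ≤ s - sord i,
      q = (tauD n A ^ k) (P i)} ↔ DRes.phi T p = 0 := by
    intro p
    rw [← DRes.mem_span_iff P hP h0 T]
    have : {q | ∃ i : Fin (n + 1), ∃ k ≤ s - sord i, q = (tauD n A ^ k) (P i)} =
        {q | ∃ x ∈ T, q = (tauD n A ^ x.2) (P x.1)} := by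
      ext q
      constructor
      · rintro ⟨i, k, hk, rfl⟩; exact ⟨(i, k), hk, rfl⟩
      · rintro ⟨⟨i, k⟩, hk, rfl⟩; exact ⟨i, k, hk, rfl⟩
    rw [this]
  have hI : ∀ p, p ∈ Ideal.span (⋃ t : ℕ, (fun q => (tauD n A ^ t) q) '' Set.range P) ↔
      DRes.phi Set.univ p = 0 := by
    intro p
    rw [← DRes.mem_span_iff P hP h0 Set.univ]
    have : (⋃ t : ℕ, (fun q => (tauD n A ^ t) q) '' Set.range P) =
        {q | ∃ x ∈ (Set.univ : Set (Fin (n + 1) × ℕ)), q = (tauD n A ^ x.2) (P x.1)} := by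
      ext q
      simp only [Set.mem_iUnion, Set.mem_image, Set.mem_range]
      constructor
      · rintro ⟨t, _, ⟨i, rfl⟩, rfl⟩; exact ⟨(i, t), trivial, rfl⟩
      · rintro ⟨⟨i, t⟩, _, rfl⟩; exact ⟨t, _, ⟨i, rfl⟩, rfl⟩
    rw [this]
  have hcongr : ∀ p : MvPolynomial (DVar n A) ℚ,
      (∀ q : CIdx n A × ℕ, Sum.inr q ∈ p.vars → q.2 ≤ s - sord q.1.1) →
      DRes.phi Set.univ p = DRes.phi T p := by
    intro p hp
    apply DRes.phi_congr
    intro q hq _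
    exact ⟨fun _ => hp q hq, fun _ => trivial⟩
  -- order bound from an explicit relation
  obtain ⟨g₀, hg₀, hg₀v, hg₀phi⟩ := DRes.exists_relation sord s hs h0 hA'
  have hvg₀ : ∀ q : CIdx n A × ℕ, Sum.inr q ∈ (rename (Sum.inr : _ → DVar n A) g₀).vars →
      q.2 ≤ s - sord q.1.1 := by
    intro q hq
    obtain ⟨q', hq', h⟩ := mem_vars_rename _ _ hq
    rw [← Sum.inr.inj h]
    exact hg₀v _ hq'
  have hord : ∀ i, ordUD R i ≤ ((s - sord i : ℕ) : WithBot ℕ) := by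
    intro i
    refine (hRminord (rename Sum.inr g₀) ?_ ?_ ?_ i).trans ?_
    · rw [hSat]
      refine ⟨1, by rw [hmY]; exact one_mem _, ?_⟩
      rw [one_mul, hI, hcongr _ hvg₀]
      exact hg₀phi
    · intro v hv
      obtain ⟨q', _, rfl⟩ := mem_vars_rename _ _ hv
      exact ⟨q'.1, q'.2, rfl⟩
    · intro h
      exact hg₀ (rename_injective _ Sum.inr_injective (by simpa using h))
    · rw [DRes.ordUD_le_iff]
      rintro q hq rfl
      exact hvg₀ q hq
  have hRphi : DRes.phi T R = 0 := by
    rw [← hcongr R (fun q hq => (DRes.ordUD_le_iff R q.1.1 _).mp (hord q.1.1) q hq rfl)]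
    rw [hSat] at hRmem
    obtain ⟨M, hM, hMR⟩ := hRmem
    rw [hmY] at hM
    obtain ⟨h1, h2⟩ := DRes.phi_mY Set.univ M hM
    rw [hI, map_mul, h1] at hMR
    exact (mul_eq_zero.mp hMR).resolve_left h2
  -- pull back to the coefficient ring
  have hpull : ∀ p : MvPolynomial (DVar n A) ℚ, (∀ v ∈ p.vars, ∃ c t, v = Sum.inr (c, t)) →
      ∃ p' : MvPolynomial (CIdx n A × ℕ) ℚ, rename Sum.inr p' = p := by
    intro p hp
    apply exists_rename_eq_of_vars_subset_range _ _ Sum.inr_injective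
    intro v hv
    obtain ⟨c, t, rfl⟩ := hp v hv
    exact ⟨(c, t), rfl⟩
  obtain ⟨R', hR'⟩ := hpull R hRu
  have hR'irr : Irreducible R' := DRes.irreducible_of_rename R' (by rw [hR']; exact hRirr)
  have key : ∀ (i₀ : Fin (n + 1)) (g : MvPolynomial (CIdx n A × ℕ) ℚ),
      Sum.inr ((⟨⟨i₀, ⟨0, h0 i₀⟩⟩, s - sord i₀⟩ : CIdx n A × ℕ)) ∉
        (rename (Sum.inr : _ → DVar n A) g).vars →
      DRes.phi T (rename Sum.inr g) = 0 → g = 0 := by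
    intro i₀ g hg hphi
    obtain ⟨μ, hμ1, hμ2⟩ := DRes.exists_matching n hn sord s hs i₀
    refine DRes.core _ sord hA1 μ hμ1 hμ2 g ?_
    rw [← hphi]
    apply DRes.phi_congr
    intro q hq hq0
    refine ⟨fun h => h.1, fun h => ⟨h, ?_⟩⟩
    intro heq
    apply hg
    obtain ⟨⟨i, α, hα⟩, k⟩ := q
    simp only [Prod.mk.injEq] at heq hq0
    obtain ⟨rfl, rfl⟩ := heq
    subst hq0
    exact hq
  refine ⟨fun g hg => ?_, fun i => le_antisymm (hord i) ?_⟩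
  · rw [hJ]
    constructor
    · intro hphi
      obtain ⟨g', rfl⟩ := hpull g hg
      rw [← hR'] at hRphi ⊢
      have := DRes.mv_dvd ((DRes.phi T).comp (rename Sum.inr)).toRingHom
        (⟨⟨0, ⟨0, h0 0⟩⟩, s - sord 0⟩ : CIdx n A × ℕ) (fun g hw hz => key 0 g (fun hh => by
          obtain ⟨q', hq', h⟩ := mem_vars_rename _ _ hh
          exact hw (Sum.inr.inj h ▸ hq')) hz) R' g' hR'irr
        hRphi hphi
      exact map_dvd _ this
    · rintro ⟨h, rfl⟩
      rw [map_mul, hRphi, zero_mul]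
  · by_contra hlt
    apply hR'irr.ne_zero
    apply key i R' _ (by rw [hR']; exact hRphi)
    intro hmem
    apply hlt
    rw [hR'] at hmem
    exact DRes.le_ordUD R _ hmem
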